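/- Let n ≥ 2 and let C ⊆ ℝ be any closed subset (for instance, the ternary Cantor set). Then the 'Cantor brush' Z = {0}^{2n-3} × C × [0,∞) × {0} ⊂ ℝ^{2n} (with C in the y_{n-1}-coordinate, [0,∞) in the x_n-coordinate, and {0} in the y_n-coordinate) is time-independent Hamiltonian excisable from (ℝ^{2n}, ω_can): there exists a smooth F : ℝ^{2n} → ℝ such that every forward trajectory of the flow of X_F starting in Z stays in Z as long as it is defined, the maximal integral curve of X_F starting at any z ∈ ℝ^{2n} ∖ Z is defined at least on [0,1], and the time-1 flow map of X_F is a symplectomorphism from ℝ^{2n} ∖ Z onto ℝ^{2n}. -/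

import Mathlib

open Set

noncomputable section

/-- `ℝ^{2n}` presented as `(p, (x_{n-1}, y_{n-1}), (xₙ, yₙ))` with
`p = (x₁,y₁,…,x_{n-2},y_{n-2}) ∈ ℝ^{2(n-2)}`; here `m = n - 2`, so `n ≥ 2`
corresponds to arbitrary `m : ℕ`. -/
abbrev EE (m : ℕ) := ((Fin m → ℝ) × (Fin m → ℝ)) × (ℝ × ℝ) × (ℝ × ℝ)

/-- The standard symplectic form on `ℝ^{2m}`. -/
def wB (m : ℕ) (u v : (Fin m → ℝ) × (Fin m → ℝ)) : ℝ :=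
  ∑ i, (u.1 i * v.2 i - u.2 i * v.1 i)

/-- The standard symplectic form `ω_can` on `ℝ^{2n} = ℝ^{2m} × (ℝ × ℝ) × (ℝ × ℝ)`. -/
def wcan (m : ℕ) (u v : EE m) : ℝ :=
  wB m u.1 v.1 + (u.2.1.1 * v.2.1.2 - u.2.1.2 * v.2.1.1)
    + (u.2.2.1 * v.2.2.2 - u.2.2.2 * v.2.2.1)

open Topology in
/-- A left inverse of a smooth injective immersion between equidimensional spaces is smooth at
every value. -/
theorem contDiffAt_leftInverse_of_injective_fderiv {V : Type*} [NormedAddCommGroup V]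
    [NormedSpace ℝ V] [FiniteDimensional ℝ V] {f g : V → V} (hf : ContDiff ℝ (⊤ : ℕ∞) f)
    (hgf : ∀ x, g (f x) = x) (x : V) (hinj : ∀ u, fderiv ℝ f x u = 0 → u = 0) :
    ContDiffAt ℝ (⊤ : ℕ∞) g (f x) := by
  have := FiniteDimensional.complete ℝ V
  have hi : Function.Injective (fderiv ℝ f x : V →ₗ[ℝ] V) :=
    (injective_iff_map_eq_zero _).2 hinj
  let e : V ≃L[ℝ] V := (LinearEquiv.ofInjectiveEndo _ hi).toContinuousLinearEquiv
  have he : HasFDerivAt f (e : V →L[ℝ] V) x := by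
    have : (e : V →L[ℝ] V) = fderiv ℝ f x := by ext u; rfl
    rw [this]
    exact (hf.differentiable (by simp) x).hasFDerivAt
  have hn : ((⊤ : ℕ∞) : WithTop ℕ∞) ≠ 0 := by simp
  have hs := hf.contDiffAt.hasStrictFDerivAt' he hn
  have hloc : g =ᶠ[𝓝 (f x)] hs.localInverse f e x :=
    hs.localInverse_unique (Filter.Eventually.of_forall hgf)
  exact (hf.contDiffAt.to_localInverse he hn).congr_of_eventuallyEq hloc

/-- Every closed subset of `ℝ` is the zero set of a smooth nonnegative function that is
`1`-Lipschitz. -/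
theorem IsClosed.exists_contDiff_zeroSet_deriv_le {C : Set ℝ} (hC : IsClosed C) :
    ∃ w : ℝ → ℝ, ContDiff ℝ (⊤ : ℕ∞) w ∧ (∀ r, 0 ≤ w r) ∧ (∀ r, w r = 0 ↔ r ∈ C) ∧
      ∀ r, deriv w r ^ 2 ≤ 1 := by
  obtain ⟨f, hsupp, hf, hrange⟩ :=
    (isClosed_closure (s := Real.arctan '' C)).isOpen_compl.exists_contDiff_support_eq
      (n := (⊤ : ℕ∞))
  have hf0 : ∀ x, 0 ≤ f x := fun x => (hrange (mem_range_self x)).1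
  have hzero : ∀ r, f (Real.arctan r) = 0 ↔ r ∈ C := by
    intro r
    have hind : Topology.IsInducing Real.arctan := by
      have h := Real.tanOrderIso.symm.toHomeomorph.isInducing
      have h2 := (Topology.IsInducing.subtypeVal).comp h
      exact h2
    have hcl : C = Real.arctan ⁻¹' closure (Real.arctan '' C) := by
      rw [← hind.closure_eq_preimage_closure_image, hC.closure_eq]
    have h1 : f (Real.arctan r) = 0 ↔ Real.arctan r ∈ closure (Real.arctan '' C) := by
      rw [← Function.notMem_support, hsupp, notMem_compl_iff]
    rw [h1]
    conv_rhs => rw [hcl]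
    rfl
  have hdf : Continuous (deriv f) := hf.continuous_deriv (by simp)
  obtain ⟨K, hK⟩ := (isCompact_Icc (a := (-2 : ℝ)) (b := 2)).exists_bound_of_continuousOn
    hdf.continuousOn
  set M := max K 1
  have hM : 0 < M := lt_max_of_lt_right one_pos
  refine ⟨fun r => f (Real.arctan r) / M, (hf.comp Real.contDiff_arctan).div_const _,
    fun r => div_nonneg (hf0 _) hM.le, fun r => ?_, fun r => ?_⟩
  · simp [hM.ne', hzero]
  · have hd : HasDerivAt (fun r => f (Real.arctan r) / M)
        (deriv f (Real.arctan r) * (1 / (1 + r ^ 2)) / M) r :=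
      (((hf.differentiable (by simp) _).hasDerivAt).comp r (Real.hasDerivAt_arctan r)).div_const M
    rw [hd.deriv, sq_le_one_iff_abs_le_one, abs_div, abs_of_pos hM, div_le_one hM, abs_mul]
    have hπ := Real.pi_lt_four
    have h1 : |deriv f (Real.arctan r)| ≤ M :=
      (hK _ ⟨by linarith [Real.neg_pi_div_two_lt_arctan r],
        by linarith [Real.arctan_lt_pi_div_two r]⟩).trans (le_max_left _ _)
    have h2 : |1 / (1 + r ^ 2)| ≤ 1 := by
      rw [abs_of_nonneg (by positivity), div_le_one (by positivity)]
      nlinarith [sq_nonneg r]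
    calc _ ≤ M * 1 := by gcongr
      _ = M := mul_one M

/-- Let `a` and `b` be smooth embeddings of `V` with `a` onto and `b` onto `{w | w - e ∉ Z}`, and
with `a^* ω = b^* ω`. If `a ⁻¹' Z = b ⁻¹' Z` and `Z` is invariant under forward
translations along `e`, then `Z` is excised by the vector field which `b ∘ a⁻¹` straightens to `e`,
and this field is Hamiltonian if `ω e` is linear. -/
theorem exists_excising_hamiltonian_of_straightening {V : Type*} [NormedAddCommGroup V]
    [NormedSpace ℝ V] [FiniteDimensional ℝ V] (ω : V → V → ℝ) (e : V) (L : V →L[ℝ] ℝ)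
    (hL : ∀ v, ω e v = L v) (a b : V → V) (Z : Set V)
    (ha : ContDiff ℝ (⊤ : ℕ∞) a) (hb : ContDiff ℝ (⊤ : ℕ∞) b)
    (ha_bij : Function.Bijective a) (hb_inj : Function.Injective b)
    (hb_range : ∀ w, w - e ∉ Z ↔ w ∈ range b)
    (hda : ∀ m u, fderiv ℝ a m u = 0 → u = 0) (hdb : ∀ m u, fderiv ℝ b m u = 0 → u = 0)
    (hω : ∀ m u v, ω (fderiv ℝ a m u) (fderiv ℝ a m v) = ω (fderiv ℝ b m u) (fderiv ℝ b m v))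
    (hab : ∀ m, a m ∈ Z ↔ b m ∈ Z) (hshift : ∀ w ∈ Z, ∀ t : ℝ, 0 ≤ t → w + t • e ∈ Z) :
    ∃ F : V → ℝ, ContDiff ℝ (⊤ : ℕ∞) F ∧
    ∃ X : V → V,
      (∀ z w, ω (X z) w = fderiv ℝ F z w) ∧
      (∀ (γ : ℝ → V) (T : ℝ), 0 ≤ T → γ 0 ∈ Z →
        (∀ t ∈ Icc 0 T, HasDerivAt γ (X (γ t)) t) →
        ∀ t ∈ Icc 0 T, γ t ∈ Z) ∧
      ∃ φ : V → V,
        (∀ z ∉ Z, ∃ γ : ℝ → V, γ 0 = z ∧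
          (∀ t ∈ Icc (0:ℝ) 1, HasDerivAt γ (X (γ t)) t) ∧ γ 1 = φ z) ∧
        ContDiffOn ℝ (⊤ : ℕ∞) φ Zᶜ ∧
        BijOn φ Zᶜ univ ∧
        (∃ ψ : V → V, ContDiff ℝ (⊤ : ℕ∞) ψ ∧ InvOn ψ φ Zᶜ univ) ∧
        (∀ z ∉ Z, ∀ u v, ω (fderiv ℝ φ z u) (fderiv ℝ φ z v) = ω u v) := by
  have hn : ((⊤ : ℕ∞) : WithTop ℕ∞) ≠ 0 := by simp
  set α := Function.invFun a
  set β := Function.invFun b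
  have hαa : ∀ m, α (a m) = m := Function.leftInverse_invFun ha_bij.1
  have haα : ∀ z, a (α z) = z := Function.rightInverse_invFun ha_bij.2
  have hβb : ∀ m, β (b m) = m := Function.leftInverse_invFun hb_inj
  have hbβ : ∀ w, w - e ∉ Z → b (β w) = w := fun w hw => by
    obtain ⟨m, rfl⟩ := (hb_range w).1 hw
    rw [hβb]
  have hbO : ∀ m, b m - e ∉ Z := fun m => (hb_range _).2 (mem_range_self m)
  have hα : ContDiff ℝ (⊤ : ℕ∞) α := contDiff_iff_contDiffAt.2 fun z => by
    obtain ⟨m, rfl⟩ := ha_bij.2 z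
    exact contDiffAt_leftInverse_of_injective_fderiv ha hαa m (hda m)
  have hβ : ∀ w, w - e ∉ Z → ContDiffAt ℝ (⊤ : ℕ∞) β w := fun w hw => by
    obtain ⟨m, rfl⟩ := (hb_range w).1 hw
    exact contDiffAt_leftInverse_of_injective_fderiv hb hβb m (hdb m)
  have ha' : ∀ m, HasFDerivAt a (fderiv ℝ a m) m :=
    fun m => (ha.differentiable hn m).hasFDerivAt
  have hb' : ∀ m, HasFDerivAt b (fderiv ℝ b m) m :=
    fun m => (hb.differentiable hn m).hasFDerivAt
  have hα' : ∀ z, HasFDerivAt α (fderiv ℝ α z) z :=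
    fun z => (hα.differentiable hn z).hasFDerivAt
  have hβ' : ∀ w, w - e ∉ Z → HasFDerivAt β (fderiv ℝ β w) w :=
    fun w hw => ((hβ w hw).differentiableAt hn).hasFDerivAt
  have hDaα : ∀ z u, fderiv ℝ a (α z) (fderiv ℝ α z u) = u := fun z u => by
    have h1 : HasFDerivAt (fun z => a (α z)) _ z := (ha' (α z)).comp z (hα' z)
    have h2 : HasFDerivAt (fun z => a (α z)) (ContinuousLinearMap.id ℝ V) z :=
      (hasFDerivAt_id z).congr_of_eventuallyEq (.of_forall haα)
    simpa using congrArg (fun A : V →L[ℝ] V => A u) (h1.unique h2)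
  have hDαa : ∀ z u, fderiv ℝ α z (fderiv ℝ a (α z) u) = u := fun z u => by
    have h := hDaα z (fderiv ℝ a (α z) u)
    rw [← sub_eq_zero, ← map_sub] at h
    exact sub_eq_zero.1 (hda _ _ h)
  have hDβb : ∀ m u, fderiv ℝ β (b m) (fderiv ℝ b m u) = u := fun m u => by
    have h1 : HasFDerivAt (fun m => β (b m)) _ m := (hβ' (b m) (hbO m)).comp m (hb' m)
    have h2 : HasFDerivAt (fun m => β (b m)) (ContinuousLinearMap.id ℝ V) m :=
      (hasFDerivAt_id m).congr_of_eventuallyEq (.of_forall hβb)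
    simpa using congrArg (fun A : V →L[ℝ] V => A u) (h1.unique h2)
  have hDbβ : ∀ m u, fderiv ℝ b m (fderiv ℝ β (b m) u) = u := fun m u => by
    have hsurj := LinearMap.injective_iff_surjective.1
      ((injective_iff_map_eq_zero (fderiv ℝ b m : V →ₗ[ℝ] V)).2 (hdb m))
    obtain ⟨v, rfl⟩ := hsurj u
    exact congrArg _ (hDβb m v)
  have hDbβ' : ∀ w, w - e ∉ Z → ∀ u, fderiv ℝ b (β w) (fderiv ℝ β w u) = u := fun w hw u => by
    obtain ⟨m, rfl⟩ := (hb_range w).1 hw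
    rw [hβb, hDbβ]
  have hmem : ∀ z, b (α z) ∈ Z ↔ z ∈ Z := fun z => by rw [← hab, haα]
  have hflow : ∀ w ∉ Z, ∀ t ≤ (1 : ℝ), w + t • e - e ∉ Z := fun w hw t ht h => by
    refine hw ?_
    have := hshift _ h (1 - t) (by linarith)
    rwa [show w + t • e - e + (1 - t) • e = w by module] at this
  have hX : ∀ z, fderiv ℝ b (α z) (fderiv ℝ α z
      (fderiv ℝ a (α z) (fderiv ℝ β (b (α z)) e))) = e := fun z => by rw [hDαa, hDbβ]
  have hback : ∀ z, b (α z) - e - e ∉ Z := fun z h => hbO (α z) <| by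
    simpa using hshift _ h 1 zero_le_one
  have hinv : InvOn (fun z => a (β (b (α z) - e))) (fun z => a (β (b (α z) + e))) Zᶜ univ := by
    refine ⟨fun z hz => ?_, fun z _ => ?_⟩
    · have hz' : b (α z) + e - e ∉ Z := fun h => hz ((hmem z).1 (by simpa using h))
      simp [hαa, hbβ _ hz', hβb, haα]
    · simp [hαa, hbβ _ (hback z), hβb, haα]
  refine ⟨fun z => L (b (α z)), L.contDiff.comp (hb.comp hα),
    fun z => fderiv ℝ a (α z) (fderiv ℝ β (b (α z)) e), ?_, ?_,
    fun z => a (β (b (α z) + e)), ?_, ?_, ?_, ?_, ?_⟩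
  · intro z w
    have h : HasFDerivAt (fun z => L (b (α z))) _ z :=
      L.hasFDerivAt.comp z ((hb' (α z)).comp z (hα' z))
    rw [h.fderiv]
    conv_lhs => rw [← hDaα z w]
    rw [hω, hDbβ, hL]
    rfl
  · intro γ T hT h0 hγ t ht
    have hder : ∀ s ∈ Icc 0 T, HasDerivAt (fun s => b (α (γ s)) - s • e) 0 s := fun s hs => by
      have h1 := ((hb' (α (γ s))).comp (γ s) (hα' (γ s))).comp_hasDerivAt s (hγ s hs)
      have h2 := h1.sub ((hasDerivAt_id s).smul_const e)
      convert! h2 using 1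
      simp [hX]
    have hc := constant_of_has_deriv_right_zero
      (fun s hs => (hder s hs).continuousAt.continuousWithinAt)
      (fun s hs => (hder s (Ico_subset_Icc_self hs)).hasDerivWithinAt) t ht
    have h3 : b (α (γ t)) = b (α (γ 0)) + t • e := by
      simpa [sub_eq_iff_eq_add] using hc
    rw [← hmem, h3]
    exact hshift _ ((hmem _).2 h0) t ht.1
  · intro z hz
    have hz' : b (α z) ∉ Z := fun h => hz ((hmem z).1 h)
    refine ⟨fun t => a (β (b (α z) + t • e)), by simp [hβb, haα], fun t ht => ?_, by simp⟩
    have hO := hflow _ hz' t ht.2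
    have h1 := ((ha' (β (b (α z) + t • e))).comp _ (hβ' _ hO)).comp_hasDerivAt t
      (((hasDerivAt_id t).smul_const e).const_add (b (α z)))
    convert! h1 using 1
    simp [hαa, hbβ _ hO]
  · intro z hz
    have hz' : b (α z) ∉ Z := fun h => hz ((hmem z).1 h)
    have h1 : ContDiffAt ℝ (⊤ : ℕ∞) β (b (α z) + e) := hβ _ (by simpa using hz')
    have h2 : ContDiffAt ℝ (⊤ : ℕ∞) (fun z => b (α z) + e) z :=
      ((hb.comp hα).add contDiff_const).contDiffAt
    exact (ha.contDiffAt.comp z (h1.comp z h2)).contDiffWithinAt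
  · exact hinv.bijOn (fun _ _ => mem_univ _) fun z _ h => by
      rw [← hmem, hαa, hbβ _ (hback z)] at h
      exact hbO _ h
  · refine ⟨_, contDiff_iff_contDiffAt.2 fun z => ?_, hinv⟩
    exact ha.contDiffAt.comp z (ContDiffAt.comp (g := β) (f := fun z => b (α z) - e) z
      (hβ _ (hback z)) ((hb.comp hα).sub contDiff_const).contDiffAt)
  · intro z hz u v
    have hz' : b (α z) ∉ Z := fun h => hz ((hmem z).1 h)
    have hO : b (α z) + e - e ∉ Z := by simpa using hz'
    have h1 : HasFDerivAt (fun z => a (β (b (α z) + e))) _ z :=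
      (ha' (β (b (α z) + e))).comp z (HasFDerivAt.comp (g := β) (f := fun z => b (α z) + e) z
        (hβ' _ hO) (((hb' (α z)).comp z (hα' z)).add_const e))
    rw [h1.fderiv]
    simp only [ContinuousLinearMap.comp_apply]
    rw [hω, hDbβ' _ hO, hDbβ' _ hO, ← hω, hDaα, hDaα]

/-- The sum of the squared positions and of nonnegative functions of the momenta which cut out the
base of the brush. -/
def brushPotential (v w : ℝ → ℝ) {m : ℕ} (z : EE m) : ℝ :=
  ∑ i, (z.1.1 i ^ 2 + v (z.1.2 i)) + (z.2.1.1 ^ 2 + w z.2.1.2)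

/-- The old coordinates `(Q, R, x, y)` of the canonical transformation with generating function
`S = (1 - exp (-x)) * E + (x + (m + 1) * x ^ 3 / 3) * E ^ 3 / 3 + x * E * brushPotential v w + Q * R'`
as functions of the mixed coordinates `(Q, R', x, E)`. -/
def brushSource (v w : ℝ → ℝ) {m : ℕ} (z : EE m) : EE m :=
  ((z.1.1, fun i => z.1.2 i + 2 * (z.2.2.1 * z.2.2.2) * z.1.1 i),
    (z.2.1.1, z.2.1.2 + 2 * (z.2.2.1 * z.2.2.2) * z.2.1.1),
    (z.2.2.1, Real.exp (-z.2.2.1) * z.2.2.2 + (1 + (m + 1) * z.2.2.1 ^ 2) * z.2.2.2 ^ 3 / 3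
      + z.2.2.2 * brushPotential v w z))

/-- The new coordinates `(Q', R', T, E)` of the canonical transformation of `brushSource` as
functions of the mixed coordinates `(Q, R', x, E)`. -/
def brushTarget (v w : ℝ → ℝ) {m : ℕ} (z : EE m) : EE m :=
  ((fun i => z.1.1 i + z.2.2.1 * z.2.2.2 * deriv v (z.1.2 i), z.1.2),
    (z.2.1.1 + z.2.2.1 * z.2.2.2 * deriv w z.2.1.2, z.2.1.2),
    (1 - Real.exp (-z.2.2.1) + (z.2.2.1 + (m + 1) * z.2.2.1 ^ 3 / 3) * z.2.2.2 ^ 2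
      + z.2.2.1 * brushPotential v w z, z.2.2.2))

/-- The Jacobian determinant of both `brushSource` and `brushTarget`. -/
def brushJacobian (v w : ℝ → ℝ) {m : ℕ} (z : EE m) : ℝ :=
  Real.exp (-z.2.2.1) + (1 + (m + 1) * z.2.2.1 ^ 2) * z.2.2.2 ^ 2 + brushPotential v w z
    - 2 * (z.2.2.1 * z.2.2.2) *
      (∑ i, z.1.1 i * deriv v (z.1.2 i) + z.2.1.1 * deriv w z.2.1.2)

theorem sq_sub_two_mul_add_sq_nonneg {x E q d : ℝ} (hd : d ^ 2 ≤ 1) :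
    0 ≤ q ^ 2 - 2 * (x * E) * (q * d) + x ^ 2 * E ^ 2 := by
  nlinarith [sq_nonneg (q - x * E * d), mul_nonneg (sq_nonneg (x * E)) (sub_nonneg.2 hd)]

section Brush

variable {v w : ℝ → ℝ} {m : ℕ}

theorem brushPotential_nonneg (hv0 : ∀ r, 0 ≤ v r) (hw0 : ∀ r, 0 ≤ w r) (z : EE m) :
    0 ≤ brushPotential v w z :=
  add_nonneg (Finset.sum_nonneg fun _ _ => add_nonneg (sq_nonneg _) (hv0 _))
    (add_nonneg (sq_nonneg _) (hw0 _))

theorem brushPotential_eq_zero_iff (hv0 : ∀ r, 0 ≤ v r) (hw0 : ∀ r, 0 ≤ w r)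
    (hv : ∀ r, v r = 0 ↔ r = 0) (z : EE m) :
    brushPotential v w z = 0 ↔ z.1 = 0 ∧ z.2.1.1 = 0 ∧ w z.2.1.2 = 0 := by
  rw [brushPotential, add_eq_zero_iff_of_nonneg
      (Finset.sum_nonneg fun _ _ => add_nonneg (sq_nonneg _) (hv0 _))
      (add_nonneg (sq_nonneg _) (hw0 _)),
    Finset.sum_eq_zero_iff_of_nonneg (fun _ _ => add_nonneg (sq_nonneg _) (hv0 _)),
    add_eq_zero_iff_of_nonneg (sq_nonneg _) (hw0 _), sq_eq_zero_iff]
  refine and_congr_left fun _ => ?_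
  simp only [add_eq_zero_iff_of_nonneg (sq_nonneg _) (hv0 _), sq_eq_zero_iff, hv, Finset.mem_univ,
    true_imp_iff, forall_and, Prod.ext_iff, funext_iff, Prod.fst_zero, Prod.snd_zero,
    Pi.zero_apply]

theorem brushJacobian_pos (hv0 : ∀ r, 0 ≤ v r) (hw0 : ∀ r, 0 ≤ w r)
    (hdv : ∀ r, deriv v r ^ 2 ≤ 1) (hdw : ∀ r, deriv w r ^ 2 ≤ 1) (z : EE m) :
    0 < brushJacobian v w z := by
  have h1 : 0 ≤ ∑ i, (z.1.1 i ^ 2 - 2 * (z.2.2.1 * z.2.2.2) * (z.1.1 i * deriv v (z.1.2 i))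
      + z.2.2.1 ^ 2 * z.2.2.2 ^ 2) :=
    Finset.sum_nonneg fun i _ => sq_sub_two_mul_add_sq_nonneg (hdv _)
  have h2 := sq_sub_two_mul_add_sq_nonneg (x := z.2.2.1) (E := z.2.2.2) (q := z.2.1.1)
    (hdw z.2.1.2)
  have h3 : 0 ≤ ∑ i, v (z.1.2 i) := Finset.sum_nonneg fun i _ => hv0 _
  simp only [Finset.sum_add_distrib, Finset.sum_sub_distrib, ← Finset.mul_sum, Finset.sum_const,
    Finset.card_univ, Fintype.card_fin, nsmul_eq_mul] at h1
  simp only [brushJacobian, brushPotential, Finset.sum_add_distrib]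
  linarith [Real.exp_pos (-z.2.2.1), hw0 z.2.1.2, sq_nonneg z.2.2.2]

theorem contDiff_brushPotential (hv : ContDiff ℝ (⊤ : ℕ∞) v) (hw : ContDiff ℝ (⊤ : ℕ∞) w) :
    ContDiff ℝ (⊤ : ℕ∞) (brushPotential v w : EE m → ℝ) := by
  unfold brushPotential
  fun_prop

theorem contDiff_brushSource (hv : ContDiff ℝ (⊤ : ℕ∞) v) (hw : ContDiff ℝ (⊤ : ℕ∞) w) :
    ContDiff ℝ (⊤ : ℕ∞) (brushSource v w : EE m → EE m) := by
  have := contDiff_brushPotential (m := m) hv hw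
  unfold brushSource
  fun_prop

theorem contDiff_brushTarget (hv : ContDiff ℝ (⊤ : ℕ∞) v) (hw : ContDiff ℝ (⊤ : ℕ∞) w) :
    ContDiff ℝ (⊤ : ℕ∞) (brushTarget v w : EE m → EE m) := by
  have := contDiff_brushPotential (m := m) hv hw
  have := (contDiff_infty_iff_deriv.1 hv).2
  have := (contDiff_infty_iff_deriv.1 hw).2
  unfold brushTarget
  fun_prop

theorem hasDerivAt_brushPotential (hv : Differentiable ℝ v) (hw : Differentiable ℝ w)
    (z u : EE m) :
    HasDerivAt (fun t : ℝ => brushPotential v w (z + t • u))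
      (∑ i, (2 * z.1.1 i * u.1.1 i + deriv v (z.1.2 i) * u.1.2 i)
        + (2 * z.2.1.1 * u.2.1.1 + deriv w z.2.1.2 * u.2.1.2)) 0 := by
  have hlin : ∀ a b : ℝ, HasDerivAt (fun t : ℝ => a + t * b) b 0 := fun a b => by
    simpa using ((hasDerivAt_id (0 : ℝ)).mul_const b).const_add a
  have hterm : ∀ f : ℝ → ℝ, Differentiable ℝ f → ∀ q r a b : ℝ,
      HasDerivAt (fun t : ℝ => (q + t * a) ^ 2 + f (r + t * b)) (2 * q * a + deriv f r * b) 0 := by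
    intro f hf q r a b
    have h1 : HasDerivAt f (deriv f r) (r + 0 * b) := by simpa using (hf r).hasDerivAt
    have h2 := ((hlin q a).fun_pow 2).add (h1.comp (0 : ℝ) (hlin r b))
    convert! h2 using 1
    simp
  exact (HasDerivAt.fun_sum fun i _ => hterm v hv _ _ _ _).add (hterm w hw _ _ _ _)

theorem fderiv_brushSource (hv : ContDiff ℝ (⊤ : ℕ∞) v) (hw : ContDiff ℝ (⊤ : ℕ∞) w)
    (z u : EE m) :
    fderiv ℝ (brushSource v w) z u =
      ((u.1.1, fun i => u.1.2 i + 2 * ((u.2.2.1 * z.2.2.2 + z.2.2.1 * u.2.2.2) * z.1.1 i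
          + z.2.2.1 * z.2.2.2 * u.1.1 i)),
        (u.2.1.1, u.2.1.2 + 2 * ((u.2.2.1 * z.2.2.2 + z.2.2.1 * u.2.2.2) * z.2.1.1
          + z.2.2.1 * z.2.2.2 * u.2.1.1)),
        (u.2.2.1, -Real.exp (-z.2.2.1) * u.2.2.1 * z.2.2.2 + Real.exp (-z.2.2.1) * u.2.2.2
          + (2 * (m + 1) * z.2.2.1 * z.2.2.2 ^ 3 / 3) * u.2.2.1
          + (1 + (m + 1) * z.2.2.1 ^ 2) * z.2.2.2 ^ 2 * u.2.2.2
          + u.2.2.2 * brushPotential v w z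
          + z.2.2.2 * (∑ i, (2 * z.1.1 i * u.1.1 i + deriv v (z.1.2 i) * u.1.2 i)
            + (2 * z.2.1.1 * u.2.1.1 + deriv w z.2.1.2 * u.2.1.2)))) := by
  have hn : ((⊤ : ℕ∞) : WithTop ℕ∞) ≠ 0 := by simp
  have hlin : ∀ a b : ℝ, HasDerivAt (fun t : ℝ => a + t * b) b 0 := fun a b => by
    simpa using ((hasDerivAt_id (0 : ℝ)).mul_const b).const_add a
  have hB := hasDerivAt_brushPotential (hv.differentiable hn) (hw.differentiable hn) z u
  have hx := hlin z.2.2.1 u.2.2.1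
  have hE := hlin z.2.2.2 u.2.2.2
  have hR : ∀ r q a b : ℝ, HasDerivAt (fun t : ℝ => r + t * b + 2 * ((z.2.2.1 + t * u.2.2.1) *
      (z.2.2.2 + t * u.2.2.2)) * (q + t * a)) (b + 2 * ((u.2.2.1 * z.2.2.2 + z.2.2.1 * u.2.2.2) * q
          + z.2.2.1 * z.2.2.2 * a)) 0 := by
    intro r q a b
    convert! (hlin r b).add (((hx.mul hE).const_mul 2).mul (hlin q a)) using 1
    simp
    ring
  have hy := ((hx.neg.exp.mul hE).add
    ((((hx.pow 2).const_mul (m + 1 : ℝ)).const_add 1).mul (hE.pow 3) |>.div_const 3)).add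
      (hE.mul hB)
  have key : HasLineDerivAt ℝ (brushSource v w) _ z u :=
    ((hasDerivAt_pi.2 fun i => hlin (z.1.1 i) (u.1.1 i)).prodMk
      (hasDerivAt_pi.2 fun i => hR (z.1.2 i) (z.1.1 i) (u.1.1 i) (u.1.2 i))).prodMk
    (((hlin z.2.1.1 u.2.1.1).prodMk (hR z.2.1.2 z.2.1.1 u.2.1.1 u.2.1.2)).prodMk
      (hx.prodMk hy))
  rw [← ((contDiff_brushSource hv hw).differentiable hn z).lineDeriv_eq_fderiv, key.lineDeriv]
  simp only [Prod.mk.injEq, true_and]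
  simp
  ring

theorem fderiv_brushTarget (hv : ContDiff ℝ (⊤ : ℕ∞) v) (hw : ContDiff ℝ (⊤ : ℕ∞) w)
    (z u : EE m) :
    fderiv ℝ (brushTarget v w) z u =
      ((fun i => u.1.1 i + ((u.2.2.1 * z.2.2.2 + z.2.2.1 * u.2.2.2) * deriv v (z.1.2 i)
          + z.2.2.1 * z.2.2.2 * (deriv (deriv v) (z.1.2 i) * u.1.2 i)), u.1.2),
        (u.2.1.1 + ((u.2.2.1 * z.2.2.2 + z.2.2.1 * u.2.2.2) * deriv w z.2.1.2
          + z.2.2.1 * z.2.2.2 * (deriv (deriv w) z.2.1.2 * u.2.1.2)), u.2.1.2),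
        (Real.exp (-z.2.2.1) * u.2.2.1
          + (1 + (m + 1) * z.2.2.1 ^ 2) * z.2.2.2 ^ 2 * u.2.2.1
          + (z.2.2.1 + (m + 1) * z.2.2.1 ^ 3 / 3) * (2 * z.2.2.2 * u.2.2.2)
          + u.2.2.1 * brushPotential v w z
          + z.2.2.1 * (∑ i, (2 * z.1.1 i * u.1.1 i + deriv v (z.1.2 i) * u.1.2 i)
            + (2 * z.2.1.1 * u.2.1.1 + deriv w z.2.1.2 * u.2.1.2)), u.2.2.2)) := by
  have hn : ((⊤ : ℕ∞) : WithTop ℕ∞) ≠ 0 := by simp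
  have hlin : ∀ a b : ℝ, HasDerivAt (fun t : ℝ => a + t * b) b 0 := fun a b => by
    simpa using ((hasDerivAt_id (0 : ℝ)).mul_const b).const_add a
  have hB := hasDerivAt_brushPotential (hv.differentiable hn) (hw.differentiable hn) z u
  have hx := hlin z.2.2.1 u.2.2.1
  have hE := hlin z.2.2.2 u.2.2.2
  have hQ : ∀ f : ℝ → ℝ, Differentiable ℝ f → ∀ r q a b : ℝ,
      HasDerivAt (fun t : ℝ => q + t * a + (z.2.2.1 + t * u.2.2.1) * (z.2.2.2 + t * u.2.2.2) *
        f (r + t * b)) (a + ((u.2.2.1 * z.2.2.2 + z.2.2.1 * u.2.2.2) * f r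
          + z.2.2.1 * z.2.2.2 * (deriv f r * b))) 0 := by
    intro f hf r q a b
    have h1 : HasDerivAt f (deriv f r) (r + 0 * b) := by simpa using (hf r).hasDerivAt
    convert! (hlin q a).add ((hx.mul hE).mul (h1.comp (0 : ℝ) (hlin r b))) using 1
    simp
  have hdv := (contDiff_infty_iff_deriv.1 hv).2.differentiable hn
  have hdw := (contDiff_infty_iff_deriv.1 hw).2.differentiable hn
  have hT := ((hx.neg.exp.const_sub 1).add
    ((hx.add (((hx.pow 3).const_mul (m + 1 : ℝ)).div_const 3)).mul (hE.pow 2))).add (hx.mul hB)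
  have key : HasLineDerivAt ℝ (brushTarget v w) _ z u :=
    ((hasDerivAt_pi.2 fun i => hQ _ hdv (z.1.2 i) (z.1.1 i) (u.1.1 i) (u.1.2 i)).prodMk
      (hasDerivAt_pi.2 fun i => hlin (z.1.2 i) (u.1.2 i))).prodMk
    (((hQ _ hdw z.2.1.2 z.2.1.1 u.2.1.1 u.2.1.2).prodMk (hlin z.2.1.2 u.2.1.2)).prodMk
      (hT.prodMk hE))
  rw [← ((contDiff_brushTarget hv hw).differentiable hn z).lineDeriv_eq_fderiv, key.lineDeriv]
  simp only [Prod.mk.injEq, true_and, and_true]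
  simp
  ring

theorem wcan_fderiv_brushSource_eq (hv : ContDiff ℝ (⊤ : ℕ∞) v) (hw : ContDiff ℝ (⊤ : ℕ∞) w)
    (z u u' : EE m) :
    wcan m (fderiv ℝ (brushSource v w) z u) (fderiv ℝ (brushSource v w) z u') =
      wcan m (fderiv ℝ (brushTarget v w) z u) (fderiv ℝ (brushTarget v w) z u') := by
  rw [fderiv_brushSource hv hw, fderiv_brushSource hv hw, fderiv_brushTarget hv hw,
    fderiv_brushTarget hv hw]
  simp only [wcan, wB]
  set x := z.2.2.1
  set E := z.2.2.2
  have h1 : ∀ c c' : ℝ, ∑ i, (u.1.1 i * (u'.1.2 i + 2 * (c' * z.1.1 i + x * E * u'.1.1 i))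
        - (u.1.2 i + 2 * (c * z.1.1 i + x * E * u.1.1 i)) * u'.1.1 i) =
      ∑ i, (u.1.1 i * u'.1.2 i - u.1.2 i * u'.1.1 i)
        + (c' * ∑ i, 2 * z.1.1 i * u.1.1 i - c * ∑ i, 2 * z.1.1 i * u'.1.1 i) := by
    intro c c'
    simp only [Finset.mul_sum, ← Finset.sum_add_distrib, ← Finset.sum_sub_distrib]
    exact Finset.sum_congr rfl fun i _ => by ring
  have h2 : ∀ c c' : ℝ, ∑ i, ((u.1.1 i + (c * deriv v (z.1.2 i)
          + x * E * (deriv (deriv v) (z.1.2 i) * u.1.2 i))) * u'.1.2 i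
        - u.1.2 i * (u'.1.1 i + (c' * deriv v (z.1.2 i)
          + x * E * (deriv (deriv v) (z.1.2 i) * u'.1.2 i)))) =
      ∑ i, (u.1.1 i * u'.1.2 i - u.1.2 i * u'.1.1 i)
        + (c * ∑ i, deriv v (z.1.2 i) * u'.1.2 i - c' * ∑ i, deriv v (z.1.2 i) * u.1.2 i) := by
    intro c c'
    simp only [Finset.mul_sum, ← Finset.sum_add_distrib, ← Finset.sum_sub_distrib]
    exact Finset.sum_congr rfl fun i _ => by ring
  rw [h1, h2]
  simp only [Finset.sum_add_distrib]
  ring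

theorem eq_zero_of_fderiv_brushSource_eq_zero (hv : ContDiff ℝ (⊤ : ℕ∞) v)
    (hw : ContDiff ℝ (⊤ : ℕ∞) w) {z u : EE m} (hz : 0 < brushJacobian v w z)
    (hu : fderiv ℝ (brushSource v w) z u = 0) : u = 0 := by
  rw [fderiv_brushSource hv hw] at hu
  obtain ⟨⟨a, b⟩, ⟨c, d⟩, ⟨x, E⟩⟩ := u
  simp only [Prod.ext_iff, Prod.fst_zero, Prod.snd_zero] at hu
  obtain ⟨⟨rfl, hb⟩, ⟨rfl, hd⟩, ⟨rfl, hy⟩⟩ := hu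
  have hb' : ∀ i, b i = -2 * z.2.2.1 * E * z.1.1 i := fun i => by
    have := congrFun hb i
    simp only [Pi.zero_apply] at this
    linarith
  have hd' : d = -2 * z.2.2.1 * E * z.2.1.1 := by linarith
  have hsum : ∑ i, deriv v (z.1.2 i) * b i
      = -2 * z.2.2.1 * E * ∑ i, z.1.1 i * deriv v (z.1.2 i) := by
    rw [Finset.mul_sum]
    exact Finset.sum_congr rfl fun i _ => by rw [hb']; ring
  have hE : brushJacobian v w z * E = 0 := by
    simp only [Finset.sum_add_distrib, hsum, hd', Pi.zero_apply, mul_zero,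
      Finset.sum_const_zero] at hy
    rw [brushJacobian, ← hy]
    ring
  obtain rfl : E = 0 := (mul_eq_zero.1 hE).resolve_left hz.ne'
  obtain rfl : b = 0 := funext fun i => by simp [hb']
  simp [hd', Prod.ext_iff]

theorem eq_zero_of_fderiv_brushTarget_eq_zero (hv : ContDiff ℝ (⊤ : ℕ∞) v)
    (hw : ContDiff ℝ (⊤ : ℕ∞) w) {z u : EE m} (hz : 0 < brushJacobian v w z)
    (hu : fderiv ℝ (brushTarget v w) z u = 0) : u = 0 := by
  rw [fderiv_brushTarget hv hw] at hu
  obtain ⟨⟨a, b⟩, ⟨c, d⟩, ⟨x, E⟩⟩ := u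
  simp only [Prod.ext_iff, Prod.fst_zero, Prod.snd_zero] at hu
  obtain ⟨⟨ha, rfl⟩, ⟨hc, rfl⟩, ⟨hT, rfl⟩⟩ := hu
  have ha' : ∀ i, a i = -x * z.2.2.2 * deriv v (z.1.2 i) := fun i => by
    have := congrFun ha i
    simp only [Pi.zero_apply] at this
    linarith
  have hc' : c = -x * z.2.2.2 * deriv w z.2.1.2 := by linarith
  have hsum : ∑ i, 2 * z.1.1 i * a i
      = -2 * x * z.2.2.2 * ∑ i, z.1.1 i * deriv v (z.1.2 i) := by
    rw [Finset.mul_sum]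
    exact Finset.sum_congr rfl fun i _ => by rw [ha']; ring
  have hx : brushJacobian v w z * x = 0 := by
    simp only [Finset.sum_add_distrib, hsum, hc', Pi.zero_apply, mul_zero,
      Finset.sum_const_zero] at hT
    rw [brushJacobian, ← hT]
    ring
  obtain rfl : x = 0 := (mul_eq_zero.1 hx).resolve_left hz.ne'
  obtain rfl : a = 0 := funext fun i => by simp [ha']
  simp [hc', Prod.ext_iff]

/-- The point with mixed coordinate `E` among those with prescribed old coordinates `(Q, R, x)`. -/
def brushSourceFiber (z : EE m) (E : ℝ) : EE m :=
  ((z.1.1, fun i => z.1.2 i - 2 * (z.2.2.1 * E) * z.1.1 i),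
    (z.2.1.1, z.2.1.2 - 2 * (z.2.2.1 * E) * z.2.1.1), (z.2.2.1, E))

/-- The point with mixed coordinate `x` among those with prescribed new coordinates
`(Q', R', E)`. -/
def brushTargetFiber (v w : ℝ → ℝ) (z : EE m) (x : ℝ) : EE m :=
  ((fun i => z.1.1 i - x * z.2.2.2 * deriv v (z.1.2 i), z.1.2),
    (z.2.1.1 - x * z.2.2.2 * deriv w z.2.1.2, z.2.1.2), (x, z.2.2.2))

theorem hasDerivAt_brushSource_fiber (hv : ContDiff ℝ (⊤ : ℕ∞) v) (hw : ContDiff ℝ (⊤ : ℕ∞) w)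
    (z : EE m) (E : ℝ) :
    HasDerivAt (fun E => (brushSource v w (brushSourceFiber z E)).2.2.2)
      (brushJacobian v w (brushSourceFiber z E)) E := by
  have hlin : ∀ r q : ℝ, HasDerivAt (fun E : ℝ => r - 2 * (z.2.2.1 * E) * q)
      (-(2 * z.2.2.1 * q)) E := fun r q => by
    convert! ((((hasDerivAt_id E).const_mul z.2.2.1).const_mul 2).mul_const q).const_sub r using 1
    ring
  have hfib : HasDerivAt (brushSourceFiber z) ((0, fun i => -(2 * z.2.2.1 * z.1.1 i)),
      (0, -(2 * z.2.2.1 * z.2.1.1)), (0, 1)) E :=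
    ((hasDerivAt_const E z.1.1).prodMk (hasDerivAt_pi.2 fun i => hlin _ _)).prodMk
      (((hasDerivAt_const E z.2.1.1).prodMk (hlin _ _)).prodMk
        ((hasDerivAt_const E z.2.2.1).prodMk (hasDerivAt_id E)))
  have h := (((contDiff_brushSource hv hw).differentiable (by simp)
    (brushSourceFiber z E)).hasFDerivAt.comp_hasDerivAt E hfib)
  rw [fderiv_brushSource hv hw] at h
  have h2 := ((hasFDerivAt_snd.comp _
      (hasFDerivAt_snd.comp _ hasFDerivAt_snd)).comp_hasDerivAt E h :
    HasDerivAt (fun E => (brushSource v w (brushSourceFiber z E)).2.2.2) _ E)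
  convert! h2 using 1
  simp only [brushJacobian, brushSourceFiber, ContinuousLinearMap.comp_apply,
    ContinuousLinearMap.coe_snd']
  have hsum : ∀ f : Fin m → ℝ, ∑ i, (2 * z.1.1 i * (0 : Fin m → ℝ) i
      + f i * -(2 * z.2.2.1 * z.1.1 i)) = -(2 * z.2.2.1) * ∑ i, z.1.1 i * f i := fun f => by
    rw [Finset.mul_sum]
    exact Finset.sum_congr rfl fun i _ => by simp; ring
  rw [hsum]
  ring

theorem hasDerivAt_brushTarget_fiber (hv : ContDiff ℝ (⊤ : ℕ∞) v) (hw : ContDiff ℝ (⊤ : ℕ∞) w)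
    (z : EE m) (x : ℝ) :
    HasDerivAt (fun x => (brushTarget v w (brushTargetFiber v w z x)).2.2.1)
      (brushJacobian v w (brushTargetFiber v w z x)) x := by
  have hlin : ∀ q d : ℝ, HasDerivAt (fun x : ℝ => q - x * z.2.2.2 * d)
      (-(z.2.2.2 * d)) x := fun q d => by
    convert! (((hasDerivAt_id x).mul_const z.2.2.2).mul_const d).const_sub q using 1
    ring
  have hfib : HasDerivAt (brushTargetFiber v w z) ((fun i => -(z.2.2.2 * deriv v (z.1.2 i)), 0),
      (-(z.2.2.2 * deriv w z.2.1.2), 0), (1, 0)) x :=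
    ((hasDerivAt_pi.2 fun i => hlin _ _).prodMk (hasDerivAt_const x z.1.2)).prodMk
      (((hlin _ _).prodMk (hasDerivAt_const x z.2.1.2)).prodMk
        ((hasDerivAt_id x).prodMk (hasDerivAt_const x z.2.2.2)))
  have h := (((contDiff_brushTarget hv hw).differentiable (by simp)
    (brushTargetFiber v w z x)).hasFDerivAt.comp_hasDerivAt x hfib)
  rw [fderiv_brushTarget hv hw] at h
  have h2 := ((hasFDerivAt_fst.comp _
      (hasFDerivAt_snd.comp _ hasFDerivAt_snd)).comp_hasDerivAt x h :
    HasDerivAt (fun x => (brushTarget v w (brushTargetFiber v w z x)).2.2.1) _ x)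
  convert! h2 using 1
  simp only [brushJacobian, brushTargetFiber, ContinuousLinearMap.comp_apply,
    ContinuousLinearMap.coe_snd', ContinuousLinearMap.coe_fst']
  have hsum : ∀ f g : Fin m → ℝ, ∑ i, (2 * f i * -(z.2.2.2 * g i)
      + g i * (0 : Fin m → ℝ) i) = -(2 * z.2.2.2) * ∑ i, f i * g i := fun f g => by
    rw [Finset.mul_sum]
    exact Finset.sum_congr rfl fun i _ => by simp; ring
  rw [hsum]
  ring

theorem brushSourceFiber_brushSource (z : EE m) :
    brushSourceFiber (brushSource v w z) z.2.2.2 = z := by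
  simp [brushSourceFiber, brushSource]

theorem brushSource_brushSourceFiber (z : EE m) (E : ℝ) :
    brushSource v w (brushSourceFiber z E)
      = (z.1, z.2.1, z.2.2.1, (brushSource v w (brushSourceFiber z E)).2.2.2) := by
  simp [brushSourceFiber, brushSource]

theorem brushTargetFiber_brushTarget (z : EE m) :
    brushTargetFiber v w (brushTarget v w z) z.2.2.1 = z := by
  simp [brushTargetFiber, brushTarget]

theorem brushTarget_brushTargetFiber (z : EE m) (x : ℝ) :
    brushTarget v w (brushTargetFiber v w z x)
      = (z.1, z.2.1, (brushTarget v w (brushTargetFiber v w z x)).2.2.1, z.2.2.2) := by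
  simp [brushTargetFiber, brushTarget]

theorem bijective_brushSource (hv : ContDiff ℝ (⊤ : ℕ∞) v) (hw : ContDiff ℝ (⊤ : ℕ∞) w)
    (hv0 : ∀ r, 0 ≤ v r) (hw0 : ∀ r, 0 ≤ w r)
    (hdv : ∀ r, deriv v r ^ 2 ≤ 1) (hdw : ∀ r, deriv w r ^ 2 ≤ 1) :
    Function.Bijective (brushSource v w : EE m → EE m) := by
  have hder := hasDerivAt_brushSource_fiber (m := m) hv hw
  have hpos := fun z => brushJacobian_pos (m := m) hv0 hw0 hdv hdw z
  constructor
  · intro z z' h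
    have hmono := strictMono_of_hasDerivAt_pos (hder (brushSource v w z)) fun _ => hpos _
    have hE : z.2.2.2 = z'.2.2.2 := hmono.injective <| by
      rw [brushSourceFiber_brushSource, h, brushSourceFiber_brushSource]
    rw [← brushSourceFiber_brushSource (v := v) (w := w) z, h, hE, brushSourceFiber_brushSource]
  · intro z
    have hcont : Continuous fun E => (brushSource v w (brushSourceFiber z E)).2.2.2 :=
      continuous_iff_continuousAt.2 fun E => (hder z E).continuousAt
    have hval : ∀ E, (brushSource v w (brushSourceFiber z E)).2.2.2
        = E * (Real.exp (-z.2.2.1) + (1 + (m + 1) * z.2.2.1 ^ 2) * E ^ 2 / 3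
          + brushPotential v w (brushSourceFiber z E)) := fun E => by
      simp only [brushSource, brushSourceFiber]
      ring
    have hbound : ∀ E, Real.exp (-z.2.2.1) ≤ Real.exp (-z.2.2.1)
        + (1 + (m + 1) * z.2.2.1 ^ 2) * E ^ 2 / 3
        + brushPotential v w (brushSourceFiber z E) := fun E => by
      have h1 := brushPotential_nonneg hv0 hw0 (brushSourceFiber z E)
      have h2 : 0 ≤ (1 + (m + 1) * z.2.2.1 ^ 2) * E ^ 2 / 3 := by positivity
      linarith
    have hexp : Real.exp z.2.2.1 * Real.exp (-z.2.2.1) = 1 := by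
      rw [← Real.exp_add, add_neg_cancel, Real.exp_zero]
    obtain ⟨E, hE⟩ := mem_range_of_exists_le_of_exists_ge (c := z.2.2.2) hcont
      ⟨-(|z.2.2.2| * Real.exp z.2.2.1), by
        rw [hval]
        refine (mul_le_mul_of_nonpos_left (hbound _) (neg_nonpos.2 (by positivity))).trans ?_
        rw [neg_mul, mul_assoc, hexp, mul_one]
        exact neg_abs_le _⟩
      ⟨|z.2.2.2| * Real.exp z.2.2.1, by
        rw [hval]
        refine le_trans ?_ (mul_le_mul_of_nonneg_left (hbound _) (by positivity))
        rw [mul_assoc, hexp, mul_one]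
        exact le_abs_self _⟩
    exact ⟨brushSourceFiber z E, by rw [brushSource_brushSourceFiber]; simp only [hE]⟩

theorem injective_brushTarget (hv : ContDiff ℝ (⊤ : ℕ∞) v) (hw : ContDiff ℝ (⊤ : ℕ∞) w)
    (hv0 : ∀ r, 0 ≤ v r) (hw0 : ∀ r, 0 ≤ w r)
    (hdv : ∀ r, deriv v r ^ 2 ≤ 1) (hdw : ∀ r, deriv w r ^ 2 ≤ 1) :
    Function.Injective (brushTarget v w : EE m → EE m) := by
  intro z z' h
  have hmono := strictMono_of_hasDerivAt_pos
    (hasDerivAt_brushTarget_fiber hv hw (brushTarget v w z))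
    fun _ => brushJacobian_pos hv0 hw0 hdv hdw _
  have hx : z.2.2.1 = z'.2.2.1 := hmono.injective <| by
    rw [brushTargetFiber_brushTarget, h, brushTargetFiber_brushTarget]
  rw [← brushTargetFiber_brushTarget (v := v) (w := w) z, h, hx, brushTargetFiber_brushTarget]

theorem mem_range_brushTarget_iff (hv : ContDiff ℝ (⊤ : ℕ∞) v) (hw : ContDiff ℝ (⊤ : ℕ∞) w)
    (hv0 : ∀ r, 0 ≤ v r) (hw0 : ∀ r, 0 ≤ w r) (z : EE m) :
    z ∈ range (brushTarget v w) ↔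
      ¬ (brushPotential v w z = 0 ∧ 1 ≤ z.2.2.1 ∧ z.2.2.2 = 0) := by
  constructor
  · rintro ⟨z, rfl⟩ ⟨hB, h1, hE⟩
    replace hE : z.2.2.2 = 0 := hE
    have hB' : brushPotential v w z = 0 := by
      simpa [brushPotential, brushTarget, hE] using hB
    simp only [brushTarget, hE, hB'] at h1
    linarith [Real.exp_pos (-z.2.2.1)]
  · intro hz
    have hcont : Continuous fun x => (brushTarget v w (brushTargetFiber v w z x)).2.2.1 :=
      continuous_iff_continuousAt.2 fun x =>
        (hasDerivAt_brushTarget_fiber hv hw z x).continuousAt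
    have hval : ∀ x, (brushTarget v w (brushTargetFiber v w z x)).2.2.1
        = 1 - Real.exp (-x) + x * ((1 + (m + 1) * x ^ 2 / 3) * z.2.2.2 ^ 2
          + brushPotential v w (brushTargetFiber v w z x)) := fun x => by
      simp only [brushTarget, brushTargetFiber]
      ring
    have hB0 : ∀ x, 0 ≤ brushPotential v w (brushTargetFiber v w z x) := fun x =>
      brushPotential_nonneg hv0 hw0 _
    have hsq : ∀ x : ℝ, z.2.2.2 ^ 2 ≤ (1 + (m + 1) * x ^ 2 / 3) * z.2.2.2 ^ 2 := fun x =>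
      le_mul_of_one_le_left (sq_nonneg _) (by
        have : 0 ≤ (m + 1) * x ^ 2 / 3 := by positivity
        linarith)
    have hlow : ∃ x, (brushTarget v w (brushTargetFiber v w z x)).2.2.1 ≤ z.2.2.1 := by
      refine ⟨min z.2.2.1 0, ?_⟩
      rw [hval]
      have h1 := Real.add_one_le_exp (-min z.2.2.1 0)
      have h2 := min_le_left z.2.2.1 0
      have h3 := mul_nonpos_of_nonpos_of_nonneg (min_le_right z.2.2.1 0)
        (add_nonneg ((sq_nonneg _).trans (hsq (min z.2.2.1 0))) (hB0 (min z.2.2.1 0)))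
      linarith
    have hlarge : ∀ x c : ℝ, 0 ≤ x → c ≤ z.2.2.2 ^ 2
        + brushPotential v w (brushTargetFiber v w z x) →
        x * c ≤ (brushTarget v w (brushTargetFiber v w z x)).2.2.1 := fun x c hx hc => by
      rw [hval]
      have h1 : Real.exp (-x) ≤ 1 := Real.exp_le_one_iff.2 (by linarith)
      have h2 := mul_le_mul_of_nonneg_left (hc.trans (add_le_add_left (hsq x) _)) hx
      linarith
    have hhigh : ∃ x, z.2.2.1 ≤ (brushTarget v w (brushTargetFiber v w z x)).2.2.1 := by
      have hcpos : ∀ c : ℝ, 0 < c → (∀ x, c ≤ z.2.2.2 ^ 2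
          + brushPotential v w (brushTargetFiber v w z x)) →
          ∃ x, z.2.2.1 ≤ (brushTarget v w (brushTargetFiber v w z x)).2.2.1 := fun c hc h => by
        refine ⟨|z.2.2.1| / c, le_trans ?_ (hlarge _ c (by positivity) (h _))⟩
        rw [div_mul_cancel₀ _ hc.ne']
        exact le_abs_self _
      by_cases hE : z.2.2.2 = 0
      · have hconst : ∀ x, brushPotential v w (brushTargetFiber v w z x)
            = brushPotential v w z := fun x => by
          simp [brushPotential, brushTargetFiber, hE]
        rcases (brushPotential_nonneg hv0 hw0 z).eq_or_lt with hB | hB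
        · have hT : z.2.2.1 < 1 := not_le.1 fun h => hz ⟨hB.symm, h, hE⟩
          refine ⟨-Real.log (1 - z.2.2.1), ?_⟩
          rw [hval, hconst, ← hB, hE, neg_neg, Real.exp_log (by linarith)]
          simp
        · exact hcpos _ hB fun x => by rw [hconst]; linarith [sq_nonneg z.2.2.2]
      · exact hcpos (z.2.2.2 ^ 2) (by positivity) fun x => by linarith [hB0 x]
    obtain ⟨x, hx⟩ := mem_range_of_exists_le_of_exists_ge (c := z.2.2.1) hcont hlow hhigh
    exact ⟨brushTargetFiber v w z x, by rw [brushTarget_brushTargetFiber]; simp only [hx]⟩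

theorem brushSource_snd_eq_zero_iff (hv0 : ∀ r, 0 ≤ v r) (hw0 : ∀ r, 0 ≤ w r) (z : EE m) :
    (brushSource v w z).2.2.2 = 0 ↔ z.2.2.2 = 0 := by
  have h : (brushSource v w z).2.2.2 = z.2.2.2 * (Real.exp (-z.2.2.1)
      + (1 + (m + 1) * z.2.2.1 ^ 2) * z.2.2.2 ^ 2 / 3 + brushPotential v w z) := by
    simp only [brushSource]
    ring
  have hpos : 0 < Real.exp (-z.2.2.1)
      + (1 + (m + 1) * z.2.2.1 ^ 2) * z.2.2.2 ^ 2 / 3 + brushPotential v w z := by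
    have h1 := brushPotential_nonneg hv0 hw0 z
    have h2 := Real.exp_pos (-z.2.2.1)
    positivity
  rw [h, mul_eq_zero, or_iff_left hpos.ne']

theorem brushSource_mem_iff_brushTarget_mem (hv0 : ∀ r, 0 ≤ v r) (hw0 : ∀ r, 0 ≤ w r) (z : EE m) :
    (brushPotential v w (brushSource v w z) = 0 ∧ 0 ≤ (brushSource v w z).2.2.1 ∧
      (brushSource v w z).2.2.2 = 0) ↔
    (brushPotential v w (brushTarget v w z) = 0 ∧ 0 ≤ (brushTarget v w z).2.2.1 ∧
      (brushTarget v w z).2.2.2 = 0) := by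
  rw [brushSource_snd_eq_zero_iff hv0 hw0]
  change _ ∧ 0 ≤ z.2.2.1 ∧ _ ↔ _ ∧ _ ∧ z.2.2.2 = 0
  rw [← and_assoc, ← and_assoc]
  refine and_congr_left fun hE => ?_
  have h1 : brushPotential v w (brushSource v w z) = brushPotential v w z := by
    simp [brushPotential, brushSource, hE]
  have h2 : brushPotential v w (brushTarget v w z) = brushPotential v w z := by
    simp [brushPotential, brushTarget, hE]
  rw [h1, h2]
  refine and_congr_right fun hB => ?_
  simp [brushTarget, hE, hB]

end Brush

/-- The "Cantor brush" `Z = {0}^{2n-3} × C × [0,∞) × {0}` (with `C` in the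
`y_{n-1}`-coordinate, `[0,∞)` in the `xₙ`-coordinate, `{0}` in the `yₙ`-coordinate)
is time-independent Hamiltonian excisable from `(ℝ^{2n}, ω_can)`, for any closed
`C ⊆ ℝ` (e.g. the ternary Cantor set). -/
theorem cantor_brush_timeIndependent_hamiltonian_excisable (m : ℕ)
    (C : Set ℝ) (hC : IsClosed C)
    (Z : Set (EE m))
    (hZ : Z = {z : EE m |
      z.1 = 0 ∧ z.2.1.1 = 0 ∧ z.2.1.2 ∈ C ∧ 0 ≤ z.2.2.1 ∧ z.2.2.2 = 0}) :
    ∃ F : EE m → ℝ, ContDiff ℝ (⊤ : ℕ∞) F ∧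
    ∃ X : EE m → EE m,
      (∀ z w, wcan m (X z) w = fderiv ℝ F z w) ∧
      (∀ (γ : ℝ → EE m) (T : ℝ), 0 ≤ T → γ 0 ∈ Z →
        (∀ t ∈ Icc 0 T, HasDerivAt γ (X (γ t)) t) →
        ∀ t ∈ Icc 0 T, γ t ∈ Z) ∧
      ∃ φ : EE m → EE m,
        (∀ z ∉ Z, ∃ γ : ℝ → EE m, γ 0 = z ∧
          (∀ t ∈ Icc (0:ℝ) 1, HasDerivAt γ (X (γ t)) t) ∧ γ 1 = φ z) ∧
        ContDiffOn ℝ (⊤ : ℕ∞) φ Zᶜ ∧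
        BijOn φ Zᶜ univ ∧
        (∃ ψ : EE m → EE m, ContDiff ℝ (⊤ : ℕ∞) ψ ∧ InvOn ψ φ Zᶜ univ) ∧
        (∀ z ∉ Z, ∀ u v, wcan m (fderiv ℝ φ z u) (fderiv ℝ φ z v) = wcan m u v) := by
  obtain ⟨v, hv, hv0, hvZ, hdv⟩ :=
    (isClosed_singleton (x := (0 : ℝ))).exists_contDiff_zeroSet_deriv_le
  obtain ⟨w, hw, hw0, hwZ, hdw⟩ := hC.exists_contDiff_zeroSet_deriv_le
  have hmem : ∀ z, z ∈ Z ↔ brushPotential v w z = 0 ∧ 0 ≤ z.2.2.1 ∧ z.2.2.2 = 0 := fun z => by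
    rw [hZ, brushPotential_eq_zero_iff hv0 hw0 hvZ, hwZ]
    simp only [mem_ofPred_eq, and_assoc]
  have hpos := brushJacobian_pos (m := m) hv0 hw0 hdv hdw
  refine exists_excising_hamiltonian_of_straightening (wcan m) (0, 0, 1, 0)
    (ContinuousLinearMap.snd ℝ _ _ ∘L ContinuousLinearMap.snd ℝ _ _ ∘L
      ContinuousLinearMap.snd ℝ _ _) (fun u => by simp [wcan, wB])
    (brushSource v w) (brushTarget v w) Z
    (contDiff_brushSource hv hw) (contDiff_brushTarget hv hw)
    (bijective_brushSource hv hw hv0 hw0 hdv hdw) (injective_brushTarget hv hw hv0 hw0 hdv hdw)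
    (fun z => ?_) (fun z _ => eq_zero_of_fderiv_brushSource_eq_zero hv hw (hpos z))
    (fun z _ => eq_zero_of_fderiv_brushTarget_eq_zero hv hw (hpos z))
    (wcan_fderiv_brushSource_eq hv hw)
    (fun z => by rw [hmem, hmem, brushSource_mem_iff_brushTarget_mem hv0 hw0])
    (fun z hz t ht => ?_)
  · rw [mem_range_brushTarget_iff hv hw hv0 hw0, hmem]
    simp [brushPotential]
  · rw [hmem] at hz ⊢
    simpa [brushPotential] using ⟨hz.1, add_nonneg hz.2.1 ht, hz.2.2⟩
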